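/- Let q be a power of an odd prime, n an odd positive integer, f = a_1X_1² + ⋯ + a_nX_n² with a_i ∈ 𝔽_q^×, and r ∈ 𝔽_q[t] monic. Then S_r(f) = φ(r)·q^{(n/2)·deg(r)} if r is a square in 𝔽_q[t], and S_r(f) = 0 otherwise. -/

import Mathlib

open Polynomial
open scoped Classical

/-- The standard additive character `ψ(x/r)` of `𝔽_q((1/t))` evaluated at `x/r` for
polynomials `x, r` with `r` monic: it equals `e_q(c)` where `c` is the coefficient of
`t^{deg r - 1}` in `x mod r`, and `e_q(a) = exp(2πi·Tr_{𝔽_q/𝔽_p}(a)/p)`. -/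
noncomputable def polyPsi (p : ℕ) [Fact p.Prime] {Fq : Type} [Field Fq]
    [Algebra (ZMod p) Fq] (r x : Polynomial Fq) : ℂ :=
  Complex.exp (2 * Real.pi * Complex.I *
    (((Algebra.trace (ZMod p) Fq ((x % r).coeff (r.natDegree - 1))).val : ℂ) / p))

/-- Euler's totient function on `𝔽_q[t]`: the number of units of `𝔽_q[t]/(r)`. -/
noncomputable def polyPhi {Fq : Type} [Field Fq] (r : Polynomial Fq) : ℕ :=
  Nat.card (Polynomial Fq ⧸ Ideal.span {r})ˣ

theorem dvd_mod_sub {F : Type} [Field F] (m x : F[X]) : m ∣ x % m - x := by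
  rw [EuclideanDomain.mod_eq_sub_mul_div]
  exact ⟨-(x / m), by ring⟩

section DegreeLT

variable (F : Type) [Field F] [Fintype F]

/-- The finite set of polynomials of degree less than `N` over a finite field. -/
noncomputable def degreeLTFinset (N : ℕ) : Finset F[X] :=
  (Finset.univ : Finset (Fin N → F)).map
    ⟨fun v => ((degreeLTEquiv F N).symm v : F[X]),
      Subtype.val_injective.comp (degreeLTEquiv F N).symm.injective⟩

variable {F}

theorem mem_degreeLTFinset {N : ℕ} {x : F[X]} :
    x ∈ degreeLTFinset F N ↔ x.degree < (N : WithBot ℕ) := by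
  simp only [degreeLTFinset, Finset.mem_map, Finset.mem_univ, true_and,
    Function.Embedding.coeFn_mk, ← mem_degreeLT]
  constructor
  · rintro ⟨v, rfl⟩
    exact ((degreeLTEquiv F N).symm v).2
  · intro h
    exact ⟨degreeLTEquiv F N ⟨x, h⟩, by simp⟩

variable (F) in
theorem card_degreeLTFinset (N : ℕ) :
    (degreeLTFinset F N).card = Fintype.card F ^ N := by
  simp [degreeLTFinset]

theorem mem_degreeLTFinset_natDegree {m x : F[X]} (hm : m.Monic) :
    x ∈ degreeLTFinset F m.natDegree ↔ x.degree < m.degree := by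
  rw [mem_degreeLTFinset, degree_eq_natDegree hm.ne_zero]

theorem mod_mem_degreeLTFinset {m : F[X]} (hm : m.Monic) (x : F[X]) :
    x % m ∈ degreeLTFinset F m.natDegree := by
  rw [mem_degreeLTFinset_natDegree hm]
  exact degree_mod_lt x hm.ne_zero

theorem eq_of_dvd_sub_of_mem_degreeLTFinset {m x y : F[X]} (hm : m.Monic)
    (hx : x ∈ degreeLTFinset F m.natDegree) (hy : y ∈ degreeLTFinset F m.natDegree)
    (h : m ∣ x - y) : x = y := by
  rw [mem_degreeLTFinset_natDegree hm] at hx hy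
  exact sub_eq_zero.1 (eq_zero_of_dvd_of_degree_lt h
    ((degree_sub_le _ _).trans_lt (max_lt hx hy)))

theorem add_mem_degreeLTFinset {N : ℕ} {x y : F[X]} (hx : x ∈ degreeLTFinset F N)
    (hy : y ∈ degreeLTFinset F N) : x + y ∈ degreeLTFinset F N := by
  rw [mem_degreeLTFinset] at *
  exact (degree_add_le _ _).trans_lt (max_lt hx hy)

theorem mul_mem_degreeLTFinset {m x : F[X]} {N : ℕ} (hm : m.Monic)
    (hx : x ∈ degreeLTFinset F N) : m * x ∈ degreeLTFinset F (m.natDegree + N) := by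
  rw [mem_degreeLTFinset] at *
  by_cases h0 : x = 0
  · simp [h0, bot_lt_iff_ne_bot]
  rw [degree_mul, degree_eq_natDegree hm.ne_zero, degree_eq_natDegree h0]
  rw [degree_eq_natDegree h0] at hx
  norm_cast at hx ⊢
  omega

theorem degreeLTFinset_mono {M N : ℕ} (h : M ≤ N) :
    degreeLTFinset F M ⊆ degreeLTFinset F N := fun x hx => by
  rw [mem_degreeLTFinset] at *
  exact hx.trans_le (by exact_mod_cast h)

/-- Summation over polynomials of degree less than `M + N` through an injective parametrization. -/
theorem sum_degreeLTFinset_add {M N : ℕ} (f : F[X] → ℂ) (i : F[X] × F[X] → F[X])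
    (hmem : ∀ y ∈ degreeLTFinset F M, ∀ z ∈ degreeLTFinset F N,
      i (y, z) ∈ degreeLTFinset F (M + N))
    (hinj : ∀ y ∈ degreeLTFinset F M, ∀ z ∈ degreeLTFinset F N,
      ∀ y' ∈ degreeLTFinset F M, ∀ z' ∈ degreeLTFinset F N,
      i (y, z) = i (y', z') → y = y' ∧ z = z') :
    ∑ x ∈ degreeLTFinset F (M + N), f x =
      ∑ y ∈ degreeLTFinset F M, ∑ z ∈ degreeLTFinset F N, f (i (y, z)) := by
  rw [← Finset.sum_product']
  symm
  have hm : Set.MapsTo i (degreeLTFinset F M ×ˢ degreeLTFinset F N : Finset _)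
      (degreeLTFinset F (M + N)) := by
    rintro ⟨y, z⟩ h
    simp only [Finset.mem_coe, Finset.mem_product] at h
    exact hmem y h.1 z h.2
  have hi : Set.InjOn i (degreeLTFinset F M ×ˢ degreeLTFinset F N : Finset _) := by
    rintro ⟨y, z⟩ h ⟨y', z'⟩ h' e
    simp only [Finset.mem_coe, Finset.mem_product] at h h'
    have := hinj y h.1 z h.2 y' h'.1 z' h'.2 e
    simp [this]
  refine Finset.sum_nbij i hm hi (Finset.surjOn_of_injOn_of_card_le i hm hi ?_)
    fun _ _ => rfl
  simp [card_degreeLTFinset, pow_add]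

theorem sum_degreeLTFinset_division {m : F[X]} (hm : m.Monic) (N : ℕ) (f : F[X] → ℂ) :
    ∑ x ∈ degreeLTFinset F (m.natDegree + N), f x =
      ∑ y ∈ degreeLTFinset F m.natDegree, ∑ z ∈ degreeLTFinset F N, f (y + m * z) := by
  refine sum_degreeLTFinset_add f (fun w => w.1 + m * w.2) ?_ ?_
  · intro y hy z hz
    exact add_mem_degreeLTFinset (degreeLTFinset_mono (by omega) hy)
      (mul_mem_degreeLTFinset hm hz)
  · intro y hy z _ y' hy' z' _ e
    simp only at e
    have hyy : y = y' := eq_of_dvd_sub_of_mem_degreeLTFinset hm hy hy'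
      ⟨z' - z, by linear_combination e⟩
    subst hyy
    exact ⟨rfl, mul_left_cancel₀ hm.ne_zero (add_left_cancel e)⟩

theorem sum_degreeLTFinset_coprime {P m : F[X]} (hP : P.Monic) (hm : m.Monic)
    (hPm : IsCoprime P m) (f : F[X] → ℂ) :
    ∑ x ∈ degreeLTFinset F (P.natDegree + m.natDegree), f x =
      ∑ y ∈ degreeLTFinset F P.natDegree, ∑ z ∈ degreeLTFinset F m.natDegree,
        f (m * y + P * z) := by
  refine sum_degreeLTFinset_add f (fun w => m * w.1 + P * w.2) ?_ ?_
  · intro y hy z hz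
    refine add_mem_degreeLTFinset ?_ (mul_mem_degreeLTFinset hP hz)
    rw [add_comm]
    exact mul_mem_degreeLTFinset hm hy
  · intro y hy z hz y' hy' z' hz' e
    simp only at e
    exact ⟨eq_of_dvd_sub_of_mem_degreeLTFinset hP hy hy'
        (hPm.dvd_of_dvd_mul_left ⟨z' - z, by linear_combination e⟩),
      eq_of_dvd_sub_of_mem_degreeLTFinset hm hz hz'
        (hPm.symm.dvd_of_dvd_mul_left ⟨y' - y, by linear_combination e⟩)⟩

theorem bijOn_mk_degreeLTFinset {P : F[X]} (hP : P.Monic) :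
    Set.BijOn (AdjoinRoot.mk P) (degreeLTFinset F P.natDegree) Set.univ := by
  refine ⟨fun _ _ => Set.mem_univ _, ?_, ?_⟩
  · intro x hx y hy e
    exact eq_of_dvd_sub_of_mem_degreeLTFinset hP hx hy (AdjoinRoot.mk_eq_mk.1 e)
  · intro k _
    obtain ⟨x, rfl⟩ := AdjoinRoot.mk_surjective k
    exact ⟨x % P, mod_mem_degreeLTFinset hP x, AdjoinRoot.mk_eq_mk.2 (dvd_mod_sub P x)⟩

theorem AdjoinRoot.finite_of_monic {P : F[X]} (hP : P.Monic) : Finite (AdjoinRoot P) := by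
  rw [← Set.finite_univ_iff, ← (bijOn_mk_degreeLTFinset hP).image_eq]
  exact (Finset.finite_toSet _).image _

/-- The number of residues coprime to `r` is Euler's totient of `r`. -/
theorem card_filter_isCoprime {r : F[X]} (hr : r.Monic) :
    ((degreeLTFinset F r.natDegree).filter (IsCoprime · r)).card = polyPhi r := by
  have hu : ∀ c : F[X], IsUnit (AdjoinRoot.mk r c) ↔ IsCoprime c r := by
    intro c
    rw [isUnit_iff_exists_inv]
    constructor
    · rintro ⟨b, hb⟩
      obtain ⟨x, rfl⟩ := AdjoinRoot.mk_surjective b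
      rw [← map_mul, ← map_one (AdjoinRoot.mk r), AdjoinRoot.mk_eq_mk] at hb
      obtain ⟨k, hk⟩ := hb
      exact ⟨x, -k, by linear_combination hk⟩
    · rintro ⟨x, y, h⟩
      refine ⟨AdjoinRoot.mk r x, ?_⟩
      rw [← map_mul, ← map_one (AdjoinRoot.mk r), AdjoinRoot.mk_eq_mk]
      exact ⟨-y, by linear_combination h⟩
  have hb := bijOn_mk_degreeLTFinset hr
  change _ = Nat.card (AdjoinRoot r)ˣ
  have : Function.Bijective fun c : (degreeLTFinset F r.natDegree).filter (IsCoprime · r) =>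
      ((hu c).2 (Finset.mem_filter.1 c.2).2).unit := by
    constructor
    · intro c d e
      have e' := congrArg Units.val e
      simp only [IsUnit.unit_spec] at e'
      exact Subtype.ext (hb.injOn (Finset.mem_filter.1 c.2).1 (Finset.mem_filter.1 d.2).1 e')
    · intro v
      obtain ⟨x, hx, hxv⟩ := hb.surjOn (Set.mem_univ (v : AdjoinRoot r))
      have hx' : IsCoprime x r := (hu x).1 (hxv ▸ v.isUnit)
      exact ⟨⟨x, Finset.mem_filter.2 ⟨hx, hx'⟩⟩, Units.ext hxv⟩
  rw [← Nat.card_congr (Equiv.ofBijective _ this), Nat.card_eq_fintype_card, Fintype.card_coe]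

end DegreeLT

/-- Values at squares and at nonsquare multiples of squares together cover a finite field twice. -/
theorem sum_sq_add_sum_nonsquare_mul_sq {K : Type} [Field K] [Fintype K]
    (hK : ringChar K ≠ 2) {ν : K} (hν : ¬ IsSquare ν) (h : K → ℂ) :
    ∑ x, h (x ^ 2) + ∑ x, h (ν * x ^ 2) = 2 * ∑ v, h v := by
  have key : ∀ g : K → ℂ, ∑ x, g (x ^ 2) = ∑ v, ((quadraticChar K v : ℤ) + 1 : ℂ) * g v := by
    intro g
    rw [← Finset.sum_fiberwise Finset.univ (fun x : K => x ^ 2)]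
    refine Finset.sum_congr rfl fun v _ => ?_
    rw [Finset.sum_congr rfl (g := fun _ => g v)
      (fun x hx => by rw [(Finset.mem_filter.1 hx).2]), Finset.sum_const, nsmul_eq_mul]
    congr 1
    have := quadraticChar_card_sqrts hK v
    rw [Set.toFinset_ofPred] at this
    exact_mod_cast this
  have h0 : ν ≠ 0 := by
    rintro rfl
    exact hν (IsSquare.zero)
  rw [key h, key (fun x => h (ν * x)),
    ← Equiv.sum_comp (Equiv.mulLeft₀ ν h0) (fun v => ((quadraticChar K v : ℤ) + 1 : ℂ) * h v),
    ← Equiv.sum_comp (Equiv.mulLeft₀ ν h0) h, ← Finset.sum_add_distrib, Finset.mul_sum]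
  refine Finset.sum_congr rfl fun v _ => ?_
  have : quadraticChar K ν = -1 := quadraticChar_neg_one_iff_not_isSquare.2 hν
  simp only [Equiv.mulLeft₀_apply, map_mul, this]
  push_cast
  ring

section Character

variable (p : ℕ) [Fact p.Prime] {F : Type} [Field F] [Algebra (ZMod p) F]

theorem polyPsi_eq (r x : F[X]) :
    polyPsi p r x =
      ZMod.stdAddChar (Algebra.trace (ZMod p) F ((x % r).coeff (r.natDegree - 1))) := by
  rw [ZMod.stdAddChar_apply, ZMod.toCircle_apply, polyPsi]
  congr 1
  ring

theorem polyPsi_add (r x y : F[X]) :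
    polyPsi p r (x + y) = polyPsi p r x * polyPsi p r y := by
  simp only [polyPsi_eq, add_mod, coeff_add, map_add, AddChar.map_add_eq_mul]

theorem polyPsi_of_dvd {r x : F[X]} (h : r ∣ x) : polyPsi p r x = 1 := by
  simp [polyPsi_eq, (EuclideanDomain.mod_eq_zero).2 h]

theorem polyPsi_congr {r x y : F[X]} (h : r ∣ x - y) : polyPsi p r x = polyPsi p r y := by
  rw [← sub_add_cancel x y, polyPsi_add, polyPsi_of_dvd p h, one_mul]

theorem polyPsi_sum {ι : Type} (s : Finset ι) (r : F[X]) (f : ι → F[X]) :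
    polyPsi p r (∑ i ∈ s, f i) = ∏ i ∈ s, polyPsi p r (f i) := by
  induction s using Finset.induction_on with
  | empty => simpa using polyPsi_of_dvd p (dvd_zero r)
  | insert i s hi ih => rw [Finset.sum_insert hi, Finset.prod_insert hi, polyPsi_add, ih]

theorem polyPsi_mul_mul {r s : F[X]} (hr : r.Monic) (hs : s.Monic) (x : F[X]) :
    polyPsi p (s * r) (s * x) = polyPsi p r x := by
  have hmod : (s * x) % (s * r) = s * (x % r) := by
    rw [← modByMonic_eq_mod _ (hs.mul hr)]
    refine (div_modByMonic_unique (x / r) _ (hs.mul hr) ⟨?_, ?_⟩).2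
    · linear_combination s * EuclideanDomain.mod_add_div x r
    · rw [degree_mul, degree_mul, degree_eq_natDegree hs.ne_zero]
      exact WithBot.add_lt_add_left (by simp) (degree_mod_lt x hr.ne_zero)
  rw [polyPsi_eq, polyPsi_eq, hmod]
  congr 2
  by_cases h0 : r.natDegree = 0
  · have : r = 1 := hr.natDegree_eq_zero.1 h0
    simp [this]
  have hle : (x % r).natDegree ≤ r.natDegree - 1 := by
    have := natDegree_mod_lt x h0
    omega
  rw [hs.natDegree_mul hr, Nat.add_sub_assoc (by omega),
    coeff_mul_add_eq_of_natDegree_le le_rfl hle, hs.coeff_natDegree, one_mul]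

variable {p} in
theorem two_ne_zero_of_algebra_zmod (hp : p ≠ 2) : (2 : F) ≠ 0 := by
  have h2 : (2 : ZMod p) ≠ 0 := by
    have : Fact (2 < p) := ⟨lt_of_le_of_ne (Fact.out : p.Prime).two_le hp.symm⟩
    have : ((2 : ℕ) : ZMod p) ≠ 0 := by
      rw [Ne, ZMod.natCast_eq_zero_iff]
      intro h
      exact absurd (Nat.le_of_dvd two_pos h) (not_le.2 Fact.out)
    exact_mod_cast this
  have := (map_ne_zero (algebraMap (ZMod p) F)).2 h2
  rwa [map_ofNat] at this

variable {p} in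
theorem ringChar_adjoinRoot_ne_two (hp : p ≠ 2) (P : F[X]) [Fact (Irreducible P)] :
    ringChar (AdjoinRoot P) ≠ 2 := by
  intro h
  have h2 := (map_ne_zero (AdjoinRoot.of P)).2 (two_ne_zero_of_algebra_zmod (F := F) hp)
  apply h2
  rw [map_ofNat]
  have := ringChar.Nat.cast_ringChar (R := AdjoinRoot P)
  rw [h] at this
  exact_mod_cast this

variable [Fintype F]

theorem exists_polyPsi_ne_one {r y : F[X]} (hr : r.Monic) (h : ¬ r ∣ y) :
    ∃ z, polyPsi p r (y * z) ≠ 1 := by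
  set w := y % r with hw
  have hw0 : w ≠ 0 := fun e => h (EuclideanDomain.mod_eq_zero.1 e)
  have hlt : w.natDegree < r.natDegree :=
    natDegree_lt_natDegree hw0 (degree_mod_lt y hr.ne_zero)
  have hlc : w.leadingCoeff ≠ 0 := leadingCoeff_ne_zero.2 hw0
  have : FiniteDimensional (ZMod p) F := Module.Finite.of_finite
  obtain ⟨β, hβ⟩ : ∃ β, Algebra.trace (ZMod p) F β = 1 := Algebra.trace_surjective _ _ 1
  refine ⟨C (w.leadingCoeff⁻¹ * β) * X ^ (r.natDegree - 1 - w.natDegree), ?_⟩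
  set z := C (w.leadingCoeff⁻¹ * β) * X ^ (r.natDegree - 1 - w.natDegree) with hz
  have hzdeg : z.natDegree ≤ r.natDegree - 1 - w.natDegree := natDegree_C_mul_X_pow_le _ _
  rw [polyPsi_congr p (y := w * z) (by
    rw [← sub_mul, ← dvd_neg, ← neg_mul, neg_sub]
    exact (dvd_mod_sub r y).mul_right z), polyPsi_eq]
  have hdeg : (w * z).degree < r.degree := by
    rw [degree_eq_natDegree hr.ne_zero]
    refine degree_le_natDegree.trans_lt ?_
    have := natDegree_mul_le (p := w) (q := z)
    norm_cast
    omega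
  have hc : (w * z).coeff (r.natDegree - 1) = β := by
    have e : r.natDegree - 1 = w.natDegree + (r.natDegree - 1 - w.natDegree) := by omega
    rw [e, coeff_mul_add_eq_of_natDegree_le le_rfl hzdeg, hz, coeff_C_mul_X_pow, if_pos rfl,
      coeff_natDegree, mul_inv_cancel_left₀ hlc]
  rw [(mod_eq_self_iff hr.ne_zero).2 hdeg, hc, hβ, ← AddChar.map_zero_eq_one (ZMod.stdAddChar (N := p))]
  exact fun e => one_ne_zero (ZMod.injective_stdAddChar e)

/-- Orthogonality of the additive characters modulo `s`. -/
theorem sum_polyPsi_mul {s : F[X]} (hs : s.Monic) (y : F[X]) :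
    ∑ z ∈ degreeLTFinset F s.natDegree, polyPsi p s (y * z) =
      if s ∣ y then (Fintype.card F : ℂ) ^ s.natDegree else 0 := by
  split_ifs with h
  · rw [Finset.sum_congr rfl fun z _ => polyPsi_of_dvd p (h.mul_right z)]
    simp [card_degreeLTFinset]
  · obtain ⟨z₀, hz₀⟩ := exists_polyPsi_ne_one p hs h
    set w := z₀ % s
    have hw : w ∈ degreeLTFinset F s.natDegree := mod_mem_degreeLTFinset hs z₀
    have hψ : polyPsi p s (y * w) = polyPsi p s (y * z₀) := by
      refine polyPsi_congr p ?_
      rw [← mul_sub]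
      exact (dvd_mod_sub s z₀).mul_left y
    have key : ∑ z ∈ degreeLTFinset F s.natDegree, polyPsi p s (y * z) =
        polyPsi p s (y * z₀) * ∑ z ∈ degreeLTFinset F s.natDegree, polyPsi p s (y * z) := by
      rw [Finset.mul_sum]
      have hm : Set.MapsTo (w + ·) (degreeLTFinset F s.natDegree : Set F[X])
          (degreeLTFinset F s.natDegree) := fun z hz => add_mem_degreeLTFinset hw hz
      have hi : Set.InjOn (w + ·) (degreeLTFinset F s.natDegree : Set F[X]) :=
        (add_right_injective w).injOn
      symm
      refine Finset.sum_nbij (w + ·) hm hi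
        (Finset.surjOn_of_injOn_of_card_le _ hm hi le_rfl) fun z _ => ?_
      simp only [mul_add, polyPsi_add, hψ]
    have : (polyPsi p s (y * z₀) - 1) *
        ∑ z ∈ degreeLTFinset F s.natDegree, polyPsi p s (y * z) = 0 := by
      linear_combination -key
    exact (mul_eq_zero.1 this).resolve_left (sub_ne_zero.2 hz₀)

/-- The quadratic Gauss sum modulo `r` with coefficient `c`. -/
noncomputable def polyGaussSum (r c : F[X]) : ℂ :=
  ∑ x ∈ degreeLTFinset F r.natDegree, polyPsi p r (c * x ^ 2)

theorem polyGaussSum_congr {r c d : F[X]} (h : r ∣ c - d) :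
    polyGaussSum p r c = polyGaussSum p r d :=
  Finset.sum_congr rfl fun x _ => polyPsi_congr p (by
    rw [← sub_mul]
    exact h.mul_right _)

/-- A square factor of the modulus splits off from a quadratic Gauss sum. -/
theorem polyGaussSum_sq_mul (hp : p ≠ 2) {s m c : F[X]} (hs : s.Monic) (hm : m.Monic)
    (hc : IsCoprime c s) :
    polyGaussSum p (s ^ 2 * m) c =
      (Fintype.card F : ℂ) ^ s.natDegree * polyGaussSum p m c := by
  have h2 : IsUnit (C (2 : F)) := isUnit_C.2 (two_ne_zero_of_algebra_zmod hp).isUnit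
  have hsm := hs.mul hm
  have hdeg : (s ^ 2 * m).natDegree = (s * m).natDegree + s.natDegree := by
    rw [(hs.pow 2).natDegree_mul hm, hs.natDegree_pow, hs.natDegree_mul hm]
    ring
  have hdvd : ∀ y : F[X], s ∣ C 2 * c * y ↔ s ∣ y := fun y => by
    rw [mul_assoc, h2.dvd_mul_left]
    exact ⟨hc.symm.dvd_of_dvd_mul_left, fun h => h.mul_left c⟩
  have step : polyGaussSum p (s ^ 2 * m) c =
      ∑ y ∈ degreeLTFinset F (s * m).natDegree, polyPsi p (s ^ 2 * m) (c * y ^ 2) *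
        if s ∣ y then (Fintype.card F : ℂ) ^ s.natDegree else 0 := by
    rw [polyGaussSum, hdeg, sum_degreeLTFinset_division hsm]
    refine Finset.sum_congr rfl fun y _ => ?_
    rw [← if_congr (hdvd y) rfl rfl, ← sum_polyPsi_mul p hs, Finset.mul_sum]
    refine Finset.sum_congr rfl fun z _ => ?_
    rw [← polyPsi_mul_mul p hs hsm (C 2 * c * y * z),
      show s * m * s = s ^ 2 * m by ring, ← polyPsi_add]
    refine polyPsi_congr p ⟨c * m * z ^ 2, ?_⟩
    rw [show (C 2 : F[X]) = 2 from rfl]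
    ring
  rw [step, hs.natDegree_mul hm, sum_degreeLTFinset_division hs,
    Finset.sum_eq_single_of_mem 0 (by simp [mem_degreeLTFinset, bot_lt_iff_ne_bot])]
  · rw [polyGaussSum, Finset.mul_sum]
    refine Finset.sum_congr rfl fun w _ => ?_
    rw [zero_add, if_pos (dvd_mul_right s w), mul_comm,
      ← polyPsi_mul_mul p hm (hs.pow 2) (c * w ^ 2)]
    congr 2
    ring
  · intro y hy hy0
    refine Finset.sum_eq_zero fun w _ => ?_
    rw [if_neg, mul_zero]
    intro h
    rw [dvd_add_left (dvd_mul_right s w)] at h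
    exact hy0 (eq_zero_of_dvd_of_degree_lt h ((mem_degreeLTFinset_natDegree hs).1 hy))

/-- A unit that is a nonresidue modulo the prime `P` and trivial modulo the coprime factor `m`
changes the sign of the quadratic Gauss sum modulo `P * m`. -/
theorem polyGaussSum_mul_nonresidue (hp : p ≠ 2) {P m c u : F[X]} (hP : P.Monic)
    (hirr : Irreducible P) (hm : m.Monic) (hPm : IsCoprime P m) (hc : IsCoprime c (P * m))
    (huP : ¬ IsSquare (AdjoinRoot.mk P u)) (hum : m ∣ u - 1) :
    polyGaussSum p (P * m) (c * u) = - polyGaussSum p (P * m) c := by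
  have : Fact (Irreducible P) := ⟨hirr⟩
  have := AdjoinRoot.finite_of_monic hP
  let := Fintype.ofFinite (AdjoinRoot P)
  have hK := ringChar_adjoinRoot_ne_two (F := F) hp P
  have hcP : IsCoprime c P := hc.of_mul_right_left
  have hnd : ¬ P ∣ c * m := fun h =>
    (hirr.coprime_iff_not_dvd.1 hPm) (hcP.symm.dvd_of_dvd_mul_left h)
  have field : ∑ x ∈ degreeLTFinset F P.natDegree, polyPsi p P (c * m * x ^ 2) +
      ∑ x ∈ degreeLTFinset F P.natDegree, polyPsi p P (c * m * (u * x ^ 2)) = 0 := by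
    have sum_mk : ∀ g : AdjoinRoot P → ℂ,
        ∑ x ∈ degreeLTFinset F P.natDegree, g (AdjoinRoot.mk P x) = ∑ k, g k := fun g => by
      have hb := bijOn_mk_degreeLTFinset hP
      exact Finset.sum_nbij (AdjoinRoot.mk P) (fun _ _ => Finset.mem_univ _) hb.injOn
        (by simpa using hb.surjOn) fun _ _ => rfl
    let h : AdjoinRoot P → ℂ := fun k =>
      polyPsi p P (c * m * Function.surjInv AdjoinRoot.mk_surjective k)
    have hh : ∀ x, polyPsi p P (c * m * x) = h (AdjoinRoot.mk P x) := fun x => by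
      refine polyPsi_congr p ?_
      rw [← mul_sub]
      refine Dvd.dvd.mul_left ?_ _
      rw [← AdjoinRoot.mk_eq_mk, Function.surjInv_eq AdjoinRoot.mk_surjective]
    have := sum_sq_add_sum_nonsquare_mul_sq hK huP h
    rw [← sum_mk, ← sum_mk, ← sum_mk] at this
    simp only [← map_pow, ← map_mul, ← hh] at this
    rw [this, sum_polyPsi_mul p hP, if_neg hnd, mul_zero]
  have split : ∀ d : F[X], polyGaussSum p (P * m) d =
      (∑ y ∈ degreeLTFinset F P.natDegree, polyPsi p P (d * m * y ^ 2)) *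
        ∑ z ∈ degreeLTFinset F m.natDegree, polyPsi p m (d * P * z ^ 2) := fun d => by
    rw [polyGaussSum, hP.natDegree_mul hm, sum_degreeLTFinset_coprime hP hm hPm,
      Finset.sum_mul_sum]
    refine Finset.sum_congr rfl fun y _ => Finset.sum_congr rfl fun z _ => ?_
    rw [← polyPsi_mul_mul p hP hm, ← polyPsi_mul_mul p hm hP, mul_comm m P, ← polyPsi_add]
    exact polyPsi_congr p ⟨2 * d * y * z, by ring⟩
  rw [split, split]
  have e1 : ∀ z, polyPsi p m (c * u * P * z ^ 2) = polyPsi p m (c * P * z ^ 2) := fun z =>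
    polyPsi_congr p (by
      rw [show c * u * P * z ^ 2 - c * P * z ^ 2 = (u - 1) * (c * P * z ^ 2) by ring]
      exact hum.mul_right _)
  simp only [e1]
  have e2 : ∀ y : F[X], c * u * m * y ^ 2 = c * m * (u * y ^ 2) := fun y => by ring
  simp only [e2]
  rw [← neg_mul]
  congr 1
  linear_combination field

variable {p} in
/-- There is a residue coprime to `r` which is a nonresidue modulo a prime `P` and trivial
modulo a divisor `k` of `r` coprime to `P`. -/
theorem exists_isCoprime_nonresidue (hp : p ≠ 2) {P k r : F[X]} (hP : P.Monic)
    (hirr : Irreducible P) (hr : r ≠ 0) (hPk : IsCoprime P k) (hkr : k ∣ r) :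
    ∃ u : F[X], IsCoprime u r ∧ ¬ IsSquare (AdjoinRoot.mk P u) ∧ k ∣ u - 1 := by
  have : Fact (Irreducible P) := ⟨hirr⟩
  have := AdjoinRoot.finite_of_monic hP
  obtain ⟨κ, hκ⟩ := FiniteField.exists_nonsquare (ringChar_adjoinRoot_ne_two (F := F) hp P)
  obtain ⟨ν, rfl⟩ := AdjoinRoot.mk_surjective κ
  have hν : IsCoprime P ν := hirr.coprime_iff_not_dvd.2 fun h =>
    hκ ((AdjoinRoot.mk_eq_zero.2 h) ▸ IsSquare.zero)
  obtain ⟨t, ht, hPt⟩ :=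
    (FiniteMultiplicity.of_not_isUnit hirr.not_isUnit hr).exists_eq_pow_mul_and_not_dvd
  set e := multiplicity P r
  obtain ⟨α, β, hαβ⟩ := hirr.coprime_iff_not_dvd.2 hPt
  have hkt : k ∣ t := (hPk.symm.pow_right (n := e)).dvd_of_dvd_mul_left (ht ▸ hkr)
  set u := ν + α * P * (1 - ν) with hu
  have hut : u = 1 + t * (β * (ν - 1)) := by
    rw [hu]
    linear_combination (1 - ν) * hαβ
  refine ⟨u, ?_, ?_, ?_⟩
  · rw [ht]
    refine IsCoprime.mul_right (IsCoprime.pow_right ?_) ?_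
    · rw [hu, show α * P * (1 - ν) = P * (α * (1 - ν)) by ring]
      exact hν.symm.add_mul_left_left _
    · rw [hut]
      exact isCoprime_one_left.add_mul_left_left _
  · have : AdjoinRoot.mk P u = AdjoinRoot.mk P ν :=
      AdjoinRoot.mk_eq_mk.2 ⟨α * (1 - ν), by rw [hu]; ring⟩
    rwa [this]
  · rw [hut, add_sub_cancel_left]
    exact hkt.mul_right _

end Character

/-- Every monic polynomial is a monic square times a monic squarefree polynomial. -/
theorem exists_sq_mul_squarefree_of_monic {F : Type} [Field F] (r : F[X]) (hr : r.Monic) :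
    ∃ s m : F[X], s.Monic ∧ m.Monic ∧ Squarefree m ∧ r = s ^ 2 * m := by
  induction hN : r.natDegree using Nat.strong_induction_on generalizing r with
  | _ N ih =>
  by_cases hsq : Squarefree r
  · exact ⟨1, r, monic_one, hr, hsq, by ring⟩
  · have : ∃ x, x * x ∣ r ∧ ¬ IsUnit x := by simpa [Squarefree] using hsq
    obtain ⟨x, hx, hxu⟩ := this
    obtain ⟨g, hg, hgi, hgx⟩ := exists_monic_irreducible_factor x hxu
    obtain ⟨k, rfl⟩ := (mul_dvd_mul hgx hgx).trans hx
    have hk : k.Monic := (hg.mul hg).of_mul_monic_left hr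
    have hgd := hgi.natDegree_pos
    rw [(hg.mul hg).natDegree_mul hk, hg.natDegree_mul hg] at hN
    obtain ⟨s, m, hs, hm, hsf, rfl⟩ := ih k.natDegree (by omega) k hk rfl
    exact ⟨g * s, m, hg.mul hs, hm, hsf, by ring⟩

/-- The complete sum factors as a sum of products of Gauss sums. -/
theorem finsum_polyPsi_eq (p : ℕ) [Fact p.Prime] {F : Type} [Field F] [Fintype F]
    [Algebra (ZMod p) F] {n : ℕ} (a : Fin n → F) (r : F[X]) :
    (∑ᶠ c ∈ {c : F[X] | c.degree < ((r.natDegree : ℕ) : WithBot ℕ) ∧ IsCoprime c r},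
      ∑ᶠ b ∈ {b : Fin n → F[X] | ∀ i, (b i).degree < ((r.natDegree : ℕ) : WithBot ℕ)},
        polyPsi p r (c * ∑ i, C (a i) * b i ^ 2)) =
      ∑ c ∈ (degreeLTFinset F r.natDegree).filter (IsCoprime · r),
        ∏ i, polyGaussSum p r (c * C (a i)) := by
  have h1 : {c : F[X] | c.degree < ((r.natDegree : ℕ) : WithBot ℕ) ∧ IsCoprime c r} =
      ↑((degreeLTFinset F r.natDegree).filter (IsCoprime · r)) := by
    ext c
    simp [mem_degreeLTFinset]
  have h2 : {b : Fin n → F[X] | ∀ i, (b i).degree < ((r.natDegree : ℕ) : WithBot ℕ)} =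
      ↑(Fintype.piFinset fun _ : Fin n => degreeLTFinset F r.natDegree) := by
    ext b
    simp [mem_degreeLTFinset]
  rw [h1, h2, finsum_mem_coe_finset]
  refine Finset.sum_congr rfl fun c _ => ?_
  simp only [polyGaussSum]
  rw [finsum_mem_coe_finset, Finset.prod_univ_sum]
  refine Finset.sum_congr rfl fun b _ => ?_
  rw [Finset.mul_sum, polyPsi_sum]
  simp only [mul_assoc]

/-- Let `q` be a power of an odd prime `p`, `n` odd positive, and
`f = a₁X₁² + ⋯ + a_nX_n²` with `a_i ∈ 𝔽_q^×`. For `r` monic,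
`S_r(f) = Σ_{a coprime to r, deg a < deg r} Σ_{b, deg b_i < deg r} ψ(a f(b)/r)`
equals `φ(r)·q^{(n·deg r)/2}` if `r` is a square in `𝔽_q[t]` (then `deg r` is even),
and `0` otherwise. -/
theorem exp_sum_odd (p : ℕ) [Fact p.Prime] (hp : p ≠ 2)
    (Fq : Type) [Field Fq] [Fintype Fq] [Algebra (ZMod p) Fq]
    (n : ℕ) (hn : 0 < n) (hnodd : Odd n) (a : Fin n → Fq) (ha : ∀ i, a i ≠ 0)
    (r : Polynomial Fq) (hr : r.Monic) :
    (∑ᶠ c ∈ {c : Polynomial Fq |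
        c.degree < ((r.natDegree : ℕ) : WithBot ℕ) ∧ IsCoprime c r},
      ∑ᶠ b ∈ {b : Fin n → Polynomial Fq |
          ∀ i, (b i).degree < ((r.natDegree : ℕ) : WithBot ℕ)},
        polyPsi p r (c * ∑ i, Polynomial.C (a i) * b i ^ 2)) =
      if IsSquare r then
        (polyPhi r : ℂ) * (Fintype.card Fq : ℂ) ^ ((n * r.natDegree) / 2)
      else 0 := by
  rw [finsum_polyPsi_eq]
  obtain ⟨s, m, hs, hm, hsf, hrsm⟩ := exists_sq_mul_squarefree_of_monic r hr
  have hcop : ∀ c i, IsCoprime c r → IsCoprime (c * C (a i)) r := fun c i h =>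
    (isCoprime_mul_unit_right_left (isUnit_C.2 (ha i).isUnit) c r).2 h
  have hsr : s ∣ r := ⟨s * m, by rw [hrsm]; ring⟩
  have hmr : m ∣ r := ⟨s ^ 2, by rw [hrsm]; ring⟩
  have hG : ∀ c, IsCoprime c r → polyGaussSum p r c =
      (Fintype.card Fq : ℂ) ^ s.natDegree * polyGaussSum p m c := fun c h => by
    rw [hrsm]
    exact polyGaussSum_sq_mul p hp hs hm (h.of_isCoprime_of_dvd_right hsr)
  by_cases hm1 : m = 1
  · have hsq : IsSquare r := ⟨s, by rw [hrsm, hm1]; ring⟩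
    have hone : ∀ c, polyGaussSum p (1 : Fq[X]) c = 1 := fun c => by
      rw [polyGaussSum, Finset.sum_congr rfl fun x _ => polyPsi_of_dvd p (one_dvd _)]
      simp [card_degreeLTFinset]
    have hdeg : n * r.natDegree / 2 = s.natDegree * n := by
      rw [hrsm, hm1, mul_one, hs.natDegree_pow]
      rw [show n * (2 * s.natDegree) = 2 * (s.natDegree * n) by ring]
      exact Nat.mul_div_cancel_left _ two_pos
    rw [if_pos hsq, hdeg, ← card_filter_isCoprime hr, ← nsmul_eq_mul, ← Finset.sum_const]
    refine Finset.sum_congr rfl fun c hc => ?_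
    rw [Finset.prod_congr rfl fun i _ => hG _ (hcop c i (Finset.mem_filter.1 hc).2)]
    simp [hm1, hone, pow_mul]
  · obtain ⟨P, hP, hirr, k, rfl⟩ :=
      exists_monic_irreducible_factor m fun h => hm1 (hm.eq_one_of_isUnit h)
    have hk : k.Monic := hP.of_mul_monic_left hm
    have hPk : IsCoprime P k := hirr.coprime_iff_not_dvd.2 fun h =>
      hirr.not_isUnit (hsf P (mul_dvd_mul_left P h))
    have hnsq : ¬ IsSquare r := by
      rintro ⟨w, hw⟩
      have hws : s ∣ w := by
        rw [← IsIntegrallyClosed.pow_dvd_pow_iff two_ne_zero, sq w, ← hw, hrsm]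
        exact dvd_mul_right _ _
      obtain ⟨v, rfl⟩ := hws
      have hv : P * k = v * v := by
        refine mul_left_cancel₀ (pow_ne_zero 2 hs.ne_zero) ?_
        rw [← hrsm, hw]
        ring
      have hPv : P ∣ v := by
        have : P ∣ v * v := ⟨k, hv.symm⟩
        exact (hirr.prime.dvd_or_dvd this).elim id id
      exact hirr.not_isUnit (hsf P (hv ▸ mul_dvd_mul hPv hPv))
    rw [if_neg hnsq]
    obtain ⟨u, hur, huP, huk⟩ : ∃ u : Fq[X], IsCoprime u r ∧
        ¬ IsSquare (AdjoinRoot.mk P u) ∧ k ∣ u - 1 :=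
      exists_isCoprime_nonresidue hp hP hirr hr.ne_zero hPk (dvd_of_mul_left_dvd hmr)
    have hgauss : ∀ c i, IsCoprime c r →
        polyGaussSum p r (c * u * C (a i)) = - polyGaussSum p r (c * C (a i)) := by
      intro c i h
      have hc := hcop c i h
      rw [show c * u * C (a i) = c * C (a i) * u by ring, hG _ (hc.mul_left hur), hG _ hc,
        polyGaussSum_mul_nonresidue p hp hP hirr hk hPk
          (hc.of_isCoprime_of_dvd_right hmr) huP huk]
      ring
    set S := (degreeLTFinset Fq r.natDegree).filter (IsCoprime · r) with hS
    have hmod : ∀ c, IsCoprime c r → IsCoprime (c % r) r := fun c h => by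
      rw [EuclideanDomain.mod_eq_sub_mul_div, sub_eq_add_neg, ← mul_neg]
      exact h.add_mul_left_left _
    have hmaps : Set.MapsTo (fun c => c * u % r) (S : Set Fq[X]) S := by
      intro c hc
      simp only [hS, Finset.coe_filter, Set.mem_ofPred_eq] at hc ⊢
      exact ⟨mod_mem_degreeLTFinset hr _, hmod _ (hc.2.mul_left hur)⟩
    have hinj : Set.InjOn (fun c => c * u % r) (S : Set Fq[X]) := by
      intro c hc d hd e
      simp only [hS, Finset.coe_filter, Set.mem_ofPred_eq] at hc hd e
      refine eq_of_dvd_sub_of_mem_degreeLTFinset hr hc.1 hd.1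
        (hur.symm.dvd_of_dvd_mul_right ?_)
      have := dvd_sub (dvd_mod_sub r (d * u)) (dvd_mod_sub r (c * u))
      rw [e] at this
      convert this using 1
      ring
    have key : ∑ c ∈ S, -∏ i, polyGaussSum p r (c * C (a i)) =
        ∑ c ∈ S, ∏ i, polyGaussSum p r (c * C (a i)) := by
      refine Finset.sum_nbij _ hmaps hinj
        (Finset.surjOn_of_injOn_of_card_le _ hmaps hinj le_rfl) fun c hc => ?_
      have hc' := (Finset.mem_filter.1 hc).2
      have hi : ∀ i, polyGaussSum p r (c * u % r * C (a i)) =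
          - polyGaussSum p r (c * C (a i)) := fun i => by
        rw [← hgauss c i hc']
        refine polyGaussSum_congr p ?_
        rw [← sub_mul]
        exact (dvd_mod_sub r (c * u)).mul_right _
      simp only [hi, Finset.prod_neg, Finset.card_univ, Fintype.card_fin, hnodd.neg_one_pow,
        neg_one_mul]
    rw [Finset.sum_neg_distrib] at key
    linear_combination -(1 / 2 : ℂ) * key
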